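/- Let G be a finite group and H a subgroup of G. Then H is a perfect code of G if and only if for every g ∈ G \ H, either the left coset gH contains an involution, or the integer |H{g,g⁻¹}H| / |H| is even, where H{g,g⁻¹}H = {h₁ x h₂ : h₁, h₂ ∈ H, x ∈ {g, g⁻¹}}. -/

import Mathlib

open scoped Pointwise

/-- A subgroup `H` of a finite group `G` is a *perfect code* of `G` if there exists a subset
`T` of `G` that is inverse-closed and is a right transversal of `H` in `G` (i.e., every element
of `G` can be written uniquely as `h * t` with `h ∈ H` and `t ∈ T`). -/
def Subgroup.IsPerfectCode {G : Type*} [Group G] (H : Subgroup G) : Prop :=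
  ∃ T : Set G, T⁻¹ = T ∧ Subgroup.IsComplement (H : Set G) T

open DoubleCoset

theorem Set.even_ncard_of_inv_eq_self {G : Type*} [Group G] {A : Set G} (hA : A.Finite)
    (hinv : A⁻¹ = A) (hsq : ∀ t ∈ A, t ^ 2 ≠ 1) : Even A.ncard := by
  classical
  rw [Set.ncard_eq_toFinset_card A hA, ← ZMod.natCast_eq_zero_iff_even, Finset.cast_card]
  refine Finset.sum_involution (fun a _ => a⁻¹) (fun a _ => ?_) (fun a ha _ h => ?_)
    (fun a ha => ?_) (fun a _ => inv_inv a)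
  · decide
  · refine hsq a (by simpa using ha) ?_
    rw [sq]
    exact mul_eq_one_iff_eq_inv.2 h.symm
  · have ha' : a ∈ A := by simpa using ha
    rw [← hinv] at ha'
    simpa using ha'

namespace Subgroup

variable {G : Type*} [Group G]

/-- Distinct elements of `T` lie in distinct right cosets of `H`. -/
def IsRightSeparated (H : Subgroup G) (T : Set G) : Prop :=
  ∀ s ∈ T, ∀ t ∈ T, s * t⁻¹ ∈ H → s = t

variable {H : Subgroup G} {T : Set G}

theorem IsRightSeparated.mono {T' : Set G} (hT : H.IsRightSeparated T) (h : T' ⊆ T) :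
    H.IsRightSeparated T' :=
  fun s hs t ht => hT s (h hs) t (h ht)

theorem IsRightSeparated.insert (hT : H.IsRightSeparated T) {x : G}
    (hx : ∀ t ∈ T, x * t⁻¹ ∉ H) : H.IsRightSeparated (insert x T) := by
  rintro s (rfl | hs) t (rfl | ht) h
  · rfl
  · exact absurd h (hx t ht)
  · exact absurd (by simpa using H.inv_mem h) (hx s hs)
  · exact hT s hs t ht h

theorem IsRightSeparated.ncard_mul (hT : H.IsRightSeparated T) :
    ((H : Set G) * T).ncard = Nat.card H * T.ncard := by
  rw [← Set.image_mul_prod, Set.InjOn.ncard_image, Set.ncard_prod]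
  · rfl
  · rintro ⟨a, s⟩ ⟨ha, hs⟩ ⟨b, t⟩ ⟨hb, ht⟩ h
    have h : a * s = b * t := h
    have hst : s = t := by
      refine hT s hs t ht ?_
      have : s * t⁻¹ = a⁻¹ * b := by
        rw [eq_inv_mul_iff_mul_eq, ← mul_assoc, h, mul_inv_cancel_right]
      rw [this]
      exact H.mul_mem (H.inv_mem ha) hb
    subst hst
    rw [mul_right_cancel h]

theorem isComplement_iff_isRightSeparated :
    IsComplement (H : Set G) T ↔
      H.IsRightSeparated T ∧ ∀ g : G, ∃ t ∈ T, g * t⁻¹ ∈ H := by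
  rw [isComplement_iff_existsUnique_mul_inv_mem]
  constructor
  · intro h
    refine ⟨fun s hs t ht hst => ?_, fun g => ?_⟩
    · have := (h s).unique (y₁ := ⟨s, hs⟩) (y₂ := ⟨t, ht⟩) (by simp) hst
      exact congrArg Subtype.val this
    · obtain ⟨t, ht, -⟩ := h g
      exact ⟨t, t.2, ht⟩
  · rintro ⟨hT, hcov⟩ g
    obtain ⟨t, ht, hgt⟩ := hcov g
    refine ⟨⟨t, ht⟩, hgt, fun s hs => Subtype.ext (hT s s.2 t ht ?_)⟩
    have := H.mul_mem (H.inv_mem hs) hgt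
    simpa [mul_assoc] using this

theorem mul_mem_doubleCoset {a g x b : G} (ha : a ∈ H) (hb : b ∈ H)
    (hx : x ∈ doubleCoset g H H) : a * x * b ∈ doubleCoset g H H := by
  obtain ⟨c, hc, d, hd, rfl⟩ := mem_doubleCoset.1 hx
  exact mem_doubleCoset.2 ⟨a * c, H.mul_mem ha hc, d * b, H.mul_mem hd hb, by simp [mul_assoc]⟩

theorem inv_doubleCoset (g : G) : (doubleCoset g H H)⁻¹ = doubleCoset g⁻¹ (H : Set G) H := by
  rw [doubleCoset, doubleCoset, mul_inv_rev, mul_inv_rev, Set.inv_singleton, inv_coe_set, mul_assoc]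

theorem mul_pair_mul (g : G) :
    (H : Set G) * {g, g⁻¹} * (H : Set G) = doubleCoset g H H ∪ doubleCoset g⁻¹ H H := by
  rw [Set.insert_eq, Set.mul_union, Set.union_mul, doubleCoset, doubleCoset]

/-- An element of order dividing two in `HgH` has a conjugate in `gH`. -/
theorem exists_sq_eq_one_of_mem_doubleCoset {g t : G} (ht : t ∈ doubleCoset g H H)
    (hsq : t ^ 2 = 1) : ∃ h ∈ H, (g * h) ^ 2 = 1 := by
  obtain ⟨a, ha, b, hb, rfl⟩ := mem_doubleCoset.1 ht
  refine ⟨b * a, H.mul_mem hb ha, ?_⟩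
  rw [show g * (b * a) = a⁻¹ * (a * g * b) * a⁻¹⁻¹ by group, conj_pow, hsq]
  simp

theorem IsPerfectCode.involution_or_even [Finite G] (hH : H.IsPerfectCode) {g : G} (hg : g ∉ H) :
    (∃ h ∈ H, (g * h) ^ 2 = 1 ∧ g * h ≠ 1) ∨
      Even (Nat.card ↥((H : Set G) * ({g, g⁻¹} : Set G) * (H : Set G)) / Nat.card H) := by
  obtain ⟨T, hTinv, hTc⟩ := hH
  obtain ⟨hT, hcov⟩ := isComplement_iff_isRightSeparated.1 hTc
  rw [or_iff_not_imp_left]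
  intro hno
  have hnsq : ∀ h ∈ H, (g * h) ^ 2 ≠ 1 := fun h hh hsq =>
    hno ⟨h, hh, hsq, fun h1 => hg (by
      rw [mul_eq_one_iff_eq_inv.1 h1]
      exact H.inv_mem hh)⟩
  rw [mul_pair_mul]
  set D := doubleCoset g (H : Set G) H ∪ doubleCoset g⁻¹ (H : Set G) H with hD
  have hDinv : D⁻¹ = D := by
    rw [hD, Set.union_inv, inv_doubleCoset, inv_doubleCoset, inv_inv, Set.union_comm]
  have hDmul : ∀ a ∈ H, ∀ x ∈ D, a * x ∈ D := by
    rintro a ha x (hx | hx)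
    · exact Or.inl (by simpa using mul_mem_doubleCoset ha H.one_mem hx)
    · exact Or.inr (by simpa using mul_mem_doubleCoset ha H.one_mem hx)
  have hHT : (H : Set G) * (T ∩ D) = D := by
    apply Set.Subset.antisymm
    · rintro _ ⟨a, ha, t, ht, rfl⟩
      exact hDmul a ha t ht.2
    · intro x hx
      obtain ⟨t, ht, hxt⟩ := hcov x
      refine ⟨x * t⁻¹, hxt, t, ⟨ht, ?_⟩, by simp⟩
      simpa using hDmul _ (H.inv_mem hxt) x hx
  have hcard := (hT.mono (Set.inter_subset_left (t := D))).ncard_mul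
  rw [hHT] at hcard
  rw [Nat.card_coe_set_eq, hcard, Nat.mul_div_cancel_left _ Nat.card_pos]
  refine Set.even_ncard_of_inv_eq_self (Set.toFinite _) (by rw [Set.inter_inv, hTinv, hDinv]) ?_
  rintro t ⟨-, ht⟩ hsq
  have htg : t ∈ doubleCoset g (H : Set G) H := by
    rcases ht with ht | ht
    · exact ht
    · rw [← inv_doubleCoset, Set.mem_inv] at ht
      rwa [← mul_eq_one_iff_eq_inv.1 ((sq t).symm.trans hsq)] at ht
  obtain ⟨h, hh, h2⟩ := exists_sq_eq_one_of_mem_doubleCoset htg hsq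
  exact hnsq h hh h2

/-- If `Hg` is missed by an inverse-closed separated set `T` and `gH` has no element of order
dividing two, then `T` also misses a right coset in `Hg⁻¹H` other than `Hg`. -/
theorem IsRightSeparated.exists_mem_doubleCoset_inv [Finite G] (hT : H.IsRightSeparated T)
    (hTinv : T⁻¹ = T) {g : G} (hgT : ∀ t ∈ T, g * t⁻¹ ∉ H) (hnsq : ∀ h ∈ H, (g * h) ^ 2 ≠ 1)
    (heven : Even (Nat.card ↥((H : Set G) * ({g, g⁻¹} : Set G) * (H : Set G)) / Nat.card H)) :
    ∃ y ∈ doubleCoset g⁻¹ (H : Set G) H, y * g⁻¹ ∉ H ∧ ∀ t ∈ T, y * t⁻¹ ∉ H := by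
  set C := doubleCoset g (H : Set G) H with hC
  have hCi : C⁻¹ = doubleCoset g⁻¹ (H : Set G) H := inv_doubleCoset g
  have hgC : g ∈ C := mem_doubleCoset_self H H g
  have hCmul : ∀ a ∈ H, ∀ x ∈ C, a * x ∈ C := fun a ha x hx => by
    simpa using mul_mem_doubleCoset ha H.one_mem hx
  have hCimul : ∀ a ∈ H, ∀ x ∈ C⁻¹, a * x ∈ C⁻¹ := fun a ha x hx => by
    rw [hCi] at hx ⊢
    simpa using mul_mem_doubleCoset ha H.one_mem hx
  have hins : H.IsRightSeparated (Insert.insert g (T ∩ C)) :=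
    (hT.mono Set.inter_subset_left).insert fun t ht => hgT t ht.1
  have hgn : g ∉ T ∩ C := fun h => hgT g h.1 (by simp)
  have hsub : (H : Set G) * Insert.insert g (T ∩ C) ⊆ C := by
    rintro _ ⟨a, ha, t, rfl | ht, rfl⟩
    · exact hCmul a ha _ hgC
    · exact hCmul a ha t ht.2
  have hcard := hins.ncard_mul
  rw [Set.ncard_insert_of_notMem hgn] at hcard
  rw [← hCi]
  by_cases hd : C⁻¹ = C
  · rw [mul_pair_mul, ← hC, ← hCi, hd, Set.union_self, Nat.card_coe_set_eq] at heven
    have hTe : Even (T ∩ C).ncard := by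
      refine Set.even_ncard_of_inv_eq_self (Set.toFinite _) (by rw [Set.inter_inv, hTinv, hd]) ?_
      rintro t ⟨-, ht⟩ hsq
      obtain ⟨h, hh, h2⟩ := exists_sq_eq_one_of_mem_doubleCoset ht hsq
      exact hnsq h hh h2
    have hne : (H : Set G) * Insert.insert g (T ∩ C) ≠ C := by
      intro h
      rw [h] at hcard
      rw [hcard, Nat.mul_div_cancel_left _ Nat.card_pos] at heven
      exact Nat.even_add_one.1 heven hTe
    obtain ⟨y, hyC, hy⟩ := Set.exists_of_ssubset (hsub.ssubset_of_ne hne)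
    refine ⟨y, hd.symm.subset hyC, fun h => hy ⟨_, h, g, Or.inl rfl, by simp⟩, fun t ht h => ?_⟩
    refine hy ⟨_, h, t, Or.inr ⟨ht, ?_⟩, by simp⟩
    simpa using hCmul _ (H.inv_mem h) y hyC
  · have hlt : ((H : Set G) * (T ∩ C⁻¹)).ncard < (C⁻¹).ncard := by
      have hle := Set.ncard_le_ncard hsub
      have hi : (T ∩ C⁻¹).ncard = (T ∩ C).ncard := by
        rw [← Set.ncard_inv (T ∩ C), Set.inter_inv, hTinv]
      rw [(hT.mono Set.inter_subset_left).ncard_mul, Set.ncard_inv, hi]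
      have : 0 < Nat.card H := Nat.card_pos
      rw [hcard] at hle
      nlinarith
    obtain ⟨y, hyC, hy⟩ := Set.exists_mem_notMem_of_ncard_lt_ncard hlt
    refine ⟨y, hyC, fun h => hd ?_, fun t ht h => ?_⟩
    · have hg : g ∈ C⁻¹ := by simpa using hCimul _ (H.inv_mem h) y hyC
      rw [hCi] at hg
      rw [hCi, hC]
      exact doubleCoset_eq_of_mem hg |>.symm
    · refine hy ⟨_, h, t, ⟨ht, ?_⟩, by simp⟩
      simpa using hCimul _ (H.inv_mem h) y hyC

theorem IsRightSeparated.insert_pair (hT : H.IsRightSeparated T) {x : G}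
    (hx : ∀ t ∈ T, x * t⁻¹ ∉ H) (hx' : ∀ t ∈ T, x⁻¹ * t⁻¹ ∉ H) (hxx : x ^ 2 ∈ H → x ^ 2 = 1) :
    H.IsRightSeparated (Insert.insert x (Insert.insert x⁻¹ T)) := by
  by_cases h : x ^ 2 = 1
  · rw [← mul_eq_one_iff_eq_inv.1 ((sq x).symm.trans h), Set.insert_idem]
    exact hT.insert hx
  · refine (hT.insert hx').insert ?_
    rintro t (rfl | ht)
    · rw [inv_inv, ← sq]
      exact fun h' => h (hxx h')
    · exact hx t ht

theorem isPerfectCode_of_involution_or_even [Finite G]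
    (hG : ∀ g : G, g ∉ H →
      (∃ h ∈ H, (g * h) ^ 2 = 1 ∧ g * h ≠ 1) ∨
        Even (Nat.card ↥((H : Set G) * ({g, g⁻¹} : Set G) * (H : Set G)) / Nat.card H)) :
    H.IsPerfectCode := by
  obtain ⟨T, ⟨hTinv, hT⟩, hmax⟩ :=
    (Set.toFinite {T : Set G | T⁻¹ = T ∧ H.IsRightSeparated T}).exists_maximal
      ⟨∅, by simp, fun _ h => h.elim⟩
  refine ⟨T, hTinv, isComplement_iff_isRightSeparated.2 ⟨hT, ?_⟩⟩
  by_contra! hcov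
  obtain ⟨g, hgT⟩ := hcov
  suffices h : ∃ x : G, (∀ t ∈ T, x * t⁻¹ ∉ H) ∧ (∀ t ∈ T, x⁻¹ * t⁻¹ ∉ H) ∧
      (x ^ 2 ∈ H → x ^ 2 = 1) by
    obtain ⟨x, hx, hx', hxx⟩ := h
    have hle := hmax (y := Insert.insert x (Insert.insert x⁻¹ T))
      ⟨by simp [Set.inv_insert, hTinv, Set.insert_comm], hT.insert_pair hx hx' hxx⟩
      (fun t ht => Or.inr (Or.inr ht))
    exact hx x (hle (Or.inl rfl)) (by simp)
  have hmiss : ∀ a ∈ H, ∀ y : G, (∀ t ∈ T, y * t⁻¹ ∉ H) → ∀ t ∈ T, a * y * t⁻¹ ∉ H :=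
    fun a ha y hy t ht h => hy t ht (by rwa [mul_assoc, H.mul_mem_cancel_left ha] at h)
  by_cases hsq : ∃ h ∈ H, (g * h) ^ 2 = 1
  · obtain ⟨h, hh, h2⟩ := hsq
    have h2' : (h * g) ^ 2 = 1 := by
      rw [show h * g = h * (g * h) * h⁻¹ by group, conj_pow, h2]
      simp
    refine ⟨h * g, hmiss h hh g hgT, ?_, fun _ => h2'⟩
    rw [← mul_eq_one_iff_eq_inv.1 ((sq (h * g)).symm.trans h2')]
    exact hmiss h hh g hgT
  · push Not at hsq
    have hg : g ∉ H := fun hg => hsq g⁻¹ (H.inv_mem hg) (by simp)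
    have heven := (hG g hg).resolve_left fun ⟨h, hh, h2, _⟩ => hsq h hh h2
    obtain ⟨y, hyC, hyg, hyT⟩ := hT.exists_mem_doubleCoset_inv hTinv hgT hsq heven
    obtain ⟨a, ha, b, hb, rfl⟩ := mem_doubleCoset.1 hyC
    have hxi : (b⁻¹ * g)⁻¹ = a⁻¹ * (a * g⁻¹ * b) := by group
    refine ⟨b⁻¹ * g, hmiss _ (H.inv_mem hb) g hgT, ?_, fun h => absurd ?_ hyg⟩
    · rw [hxi]
      exact hmiss _ (H.inv_mem ha) _ hyT
    · have : a * g⁻¹ * b * g⁻¹ = a * ((b⁻¹ * g) ^ 2)⁻¹ * b⁻¹ := by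
        rw [sq]
        group
      rw [this]
      exact H.mul_mem (H.mul_mem ha (H.inv_mem h)) (H.inv_mem hb)

end Subgroup

theorem isPerfectCode_iff_involution_or_even {G : Type*} [Group G] [Finite G] (H : Subgroup G) :
    H.IsPerfectCode ↔
      ∀ g : G, g ∉ H →
        (∃ h ∈ H, (g * h) ^ 2 = 1 ∧ g * h ≠ 1) ∨
          Even (Nat.card ↥((H : Set G) * ({g, g⁻¹} : Set G) * (H : Set G)) / Nat.card H) :=
  ⟨fun h _ hg => h.involution_or_even hg, Subgroup.isPerfectCode_of_involution_or_even⟩
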